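/- arXiv:1512.02038 — 2 statements merged into one kernel-verified Lean document; each statement's English description precedes it below -/
import Mathlib

section
/- Let T > 0, J = [0,T], and let F, G, X : J → ℝ be continuous nonnegative functions with X continuously differentiable on J. Suppose that X(t)² ≤ X(0)² + ∫₀ᵗ (F(s)·X(s) + G(s)) ds for all t ∈ J. Then for every t ∈ J, X(t) ≤ X(0) + max{ 2·∫₀ᵗ F(s) ds , ( 2·∫₀ᵗ G(s) ds )^{1/2} }. -/
open Set intervalIntegral

/-- the improved Grönwall-type lemma (Lemma 3.1 of the paper). -/
theorem stmt_0 (T : ℝ) (hT : 0 < T) (F G X : ℝ → ℝ)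
    (hF : ContinuousOn F (Icc 0 T)) (hG : ContinuousOn G (Icc 0 T))
    (hX : ContinuousOn X (Icc 0 T))
    (hFnn : ∀ t ∈ Icc 0 T, 0 ≤ F t) (hGnn : ∀ t ∈ Icc 0 T, 0 ≤ G t)
    (hXnn : ∀ t ∈ Icc 0 T, 0 ≤ X t)
    (hXC1 : ContDiffOn ℝ 1 X (Icc 0 T))
    (hineq : ∀ t ∈ Icc 0 T,
      X t ^ 2 ≤ X 0 ^ 2 + ∫ s in (0:ℝ)..t, (F s * X s + G s)) :
    ∀ t ∈ Icc 0 T,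
      X t ≤ X 0 + max (2 * ∫ s in (0:ℝ)..t, F s)
        (Real.sqrt (2 * ∫ s in (0:ℝ)..t, G s)) := by
  intro t ht
  have hst : Icc 0 t ⊆ Icc 0 T := Icc_subset_Icc_right ht.2
  obtain ⟨r, hr, hmax⟩ :=
    isCompact_Icc.exists_isMaxOn (nonempty_Icc.2 ht.1) (hX.mono hst)
  have hrT : Icc 0 r ⊆ Icc 0 T := (Icc_subset_Icc_right hr.2).trans hst
  have hFi : IntervalIntegrable F MeasureTheory.volume 0 t :=
    (hF.mono hst).intervalIntegrable_of_Icc ht.1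
  have hGi : IntervalIntegrable G MeasureTheory.volume 0 t :=
    (hG.mono hst).intervalIntegrable_of_Icc ht.1
  have hdom : IntervalIntegrable (fun s => F s * X r + G s) MeasureTheory.volume 0 t :=
    (hFi.mul_const _).add hGi
  have hint : ∫ s in (0:ℝ)..r, (F s * X s + G s) ≤
      (∫ s in (0:ℝ)..t, F s) * X r + ∫ s in (0:ℝ)..t, G s := calc
    _ ≤ ∫ s in (0:ℝ)..r, (F s * X r + G s) := by
      refine integral_mono_on hr.1
        ((((hF.mul hX).add hG).mono hrT).intervalIntegrable_of_Icc hr.1)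
        ((((hF.mul continuousOn_const).add hG).mono hrT).intervalIntegrable_of_Icc hr.1) ?_
      intro s hs
      gcongr
      · exact hFnn s (hrT hs)
      · exact hmax ⟨hs.1, hs.2.trans hr.2⟩
    _ ≤ ∫ s in (0:ℝ)..t, (F s * X r + G s) := by
      refine integral_mono_interval le_rfl hr.1 hr.2 ?_ hdom
      filter_upwards [MeasureTheory.ae_restrict_mem measurableSet_Ioc] with s hs
      have hsT : s ∈ Icc 0 T := hst ⟨hs.1.le, hs.2⟩
      exact add_nonneg (mul_nonneg (hFnn s hsT) (hXnn r (hst hr))) (hGnn s hsT)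
    _ = _ := by
      rw [integral_add (hFi.mul_const _) hGi, integral_mul_const]
  have hB : 0 ≤ ∫ s in (0:ℝ)..t, G s :=
    integral_nonneg ht.1 fun s hs => hGnn s (hst hs)
  have hX0 : 0 ≤ X 0 := hXnn 0 ⟨le_rfl, hT.le⟩
  have hXr : 0 ≤ X r := hXnn r (hst hr)
  have hXt : X t ≤ X r := hmax ⟨ht.1, le_rfl⟩
  have hsq := (hineq r (hst hr)).trans (add_le_add_right hint _)
  generalize (∫ s in (0:ℝ)..t, F s) = A at *
  generalize (∫ s in (0:ℝ)..t, G s) = B at *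
  have hA_le := le_max_left (2 * A) (√(2 * B))
  have hB_le := le_max_right (2 * A) (√(2 * B))
  generalize max (2 * A) (√(2 * B)) = m at *
  have hm : 0 ≤ m := (Real.sqrt_nonneg _).trans hB_le
  have hBm : 2 * B ≤ m ^ 2 := (Real.sqrt_le_left hm).1 hB_le
  refine hXt.trans ?_
  by_contra! hlt
  have hAm : A * X r ≤ m / 2 * X r := by gcongr; linarith
  nlinarith [mul_nonneg hX0 hm,
    mul_le_mul hlt.le (show X 0 + m / 2 ≤ X r - m / 2 by linarith) (by positivity) hXr,
    mul_pos (sub_pos.2 hlt) (show 0 < X r by linarith)]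
end

section
/- Let H, W, V, Q be real inner product spaces, let Σ and Γ be linear subspaces of H, and let D_Σ : Σ → V, D_W : W → Q, ι : Q → H be linear maps. Let a : H×H → ℝ and k : W×W → ℝ be symmetric positive definite bilinear forms, let s : Q×Q → ℝ be a symmetric positive semidefinite bilinear form, and let Δt > 0. Assume: (S3) for every q ∈ Q there exists w ∈ W with D_W w = q; (S4) for every v ∈ V and η ∈ Γ there exists τ ∈ Σ with D_Σ τ = v and ⟨τ, η′⟩ = ⟨η, η′⟩ for all η′ ∈ Γ. Suppose (σ, u, γ, z, p) ∈ Σ×V×Γ×W×Q satisfies the homogeneous system: a(σ + ιp, τ) + ⟨u, D_Σ τ⟩ + ⟨γ, τ⟩ = 0 for all τ ∈ Σ; ⟨D_Σ σ, v⟩ + ⟨σ, η⟩ = 0 for all v ∈ V and η ∈ Γ; k(z, w) + ⟨p, D_W w⟩ = 0 for all w ∈ W; and s(p, q) + a(σ + ιp, ιq) − Δt·⟨D_W z, q⟩ = 0 for all q ∈ Q. Then σ = 0, u = 0, γ = 0, z = 0, and p = 0. (This is the uniqueness, and hence well-posedness, of each time step of the backward Euler discretization of the four-field mixed formulation of Biot's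 consolidation model, stated abstractly: a plays the role of the compliance form (𝒜·,·), k of (κ^{-1}·,·), s of (s₀·,·), ι of q ↦ αqI, D_Σ and D_W of the divergence operators, and (S3), (S4) are the discrete inf-sup conditions.) -/
open scoped RealInnerProductSpace

/-- uniqueness (hence well-posedness) of each backward Euler time
step of the four-field mixed formulation of Biot's consolidation model, stated
abstractly. -/
theorem stmt_17 {H W V Q : Type*}
    [NormedAddCommGroup H] [InnerProductSpace ℝ H]
    [NormedAddCommGroup W] [InnerProductSpace ℝ W]
    [NormedAddCommGroup V] [InnerProductSpace ℝ V]
    [NormedAddCommGroup Q] [InnerProductSpace ℝ Q]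
    (S G : Submodule ℝ H)
    (DS : S →ₗ[ℝ] V) (DW : W →ₗ[ℝ] Q) (ι : Q →ₗ[ℝ] H)
    (a : H →ₗ[ℝ] H →ₗ[ℝ] ℝ) (k : W →ₗ[ℝ] W →ₗ[ℝ] ℝ) (s : Q →ₗ[ℝ] Q →ₗ[ℝ] ℝ)
    (ha_symm : ∀ x y : H, a x y = a y x) (ha_pos : ∀ x : H, x ≠ 0 → 0 < a x x)
    (hk_symm : ∀ x y : W, k x y = k y x) (hk_pos : ∀ x : W, x ≠ 0 → 0 < k x x)
    (hs_symm : ∀ x y : Q, s x y = s y x) (hs_nonneg : ∀ x : Q, 0 ≤ s x x)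
    (Δt : ℝ) (hΔt : 0 < Δt)
    (hS3 : ∀ q : Q, ∃ w : W, DW w = q)
    (hS4 : ∀ (v : V) (η : G), ∃ τ : S, DS τ = v ∧
      ∀ η' : G, ⟪(τ : H), (η' : H)⟫ = ⟪(η : H), (η' : H)⟫)
    (σ : S) (u : V) (γ : G) (z : W) (p : Q)
    (heq1 : ∀ τ : S, a ((σ : H) + ι p) (τ : H) + ⟪u, DS τ⟫ + ⟪(γ : H), (τ : H)⟫ = 0)
    (heq2 : ∀ (v : V) (η : G), ⟪DS σ, v⟫ + ⟪(σ : H), (η : H)⟫ = 0)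
    (heq3 : ∀ w : W, k z w + ⟪p, DW w⟫ = 0)
    (heq4 : ∀ q : Q, s p q + a ((σ : H) + ι p) (ι q) - Δt * ⟪DW z, q⟫ = 0) :
    (σ : H) = 0 ∧ u = 0 ∧ (γ : H) = 0 ∧ z = 0 ∧ p = 0 := by
  have nonneg_a : ∀ x : H, 0 ≤ a x x := fun x => by
    by_cases hx : x = 0
    · simp [hx]
    · exact (ha_pos x hx).le
  have nonneg_k : ∀ x : W, 0 ≤ k x x := fun x => by
    by_cases hx : x = 0
    · simp [hx]
    · exact (hk_pos x hx).le
  have energy : s p p + a (σ + ι p) (σ + ι p) + Δt * k z z = 0 := by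
    have h1 := heq1 σ
    have h2 := heq2 u γ
    have h3 := heq3 z
    have h4 := heq4 p
    rw [real_inner_comm, real_inner_comm (σ : H)] at h1
    rw [real_inner_comm] at h4
    rw [map_add (a (σ + ι p))]
    linear_combination h1 - h2 + Δt * h3 + h4
  have hX : (σ : H) + ι p = 0 := by
    by_contra hne
    linarith [ha_pos _ hne, hs_nonneg p, mul_nonneg hΔt.le (nonneg_k z)]
  have hz : z = 0 := by
    by_contra hne
    linarith [nonneg_a (σ + ι p), hs_nonneg p, mul_pos hΔt (hk_pos z hne)]
  have hp : p = 0 := by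
    obtain ⟨w, hw⟩ := hS3 p
    have h := heq3 w
    simpa [hw, hz] using h
  obtain ⟨τ, hτ, hτG⟩ := hS4 u γ
  have hsum : ⟪u, u⟫ + ⟪(γ : H), (γ : H)⟫ = 0 := by
    have h := heq1 τ
    rw [real_inner_comm (τ : H), hτG γ, hτ, hX] at h
    simpa only [map_zero, LinearMap.zero_apply, zero_add] using h
  have hu := real_inner_self_nonneg (x := u)
  have hγ := real_inner_self_nonneg (x := (γ : H))
  refine ⟨?_, ?_, ?_, hz, hp⟩
  · simpa [hp] using hX
  · exact inner_self_eq_zero (𝕜 := ℝ).mp (by linarith)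
  · exact inner_self_eq_zero (𝕜 := ℝ).mp (by linarith)
end
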